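/- Let λ_0 < λ_1 < ⋯ < λ_m be nonnegative integers and Q(t) = Σ_{j=0}^m A_j cos(λ_j t) with real A_j. Then ∫_{−π}^{π} |Q(t)| dt ≥ (1/60) Σ_{j=0}^m |A_{m−j}| / (j+1). -/

import Mathlib

open Complex Real ComplexConjugate

/-- A function continuous on `ℂ` is circle integrable over the unit circle. -/
theorem Continuous.circleIntegrable_zero_one {E : Type*} [NormedAddCommGroup E] {g : ℂ → E}
    (hg : Continuous g) : CircleIntegrable g 0 1 :=
  hg.continuousOn.circleIntegrable zero_le_one

theorem Differentiable.circleAverage_zero_one {g : ℂ → ℂ} (hg : Differentiable ℂ g) :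
    circleAverage g 0 1 = g 0 :=
  hg.diffContOnCl.circleAverage

theorem circleAverage_conj {g : ℂ → ℂ} (hg : Continuous g) :
    circleAverage (fun z ↦ conj (g z)) 0 1 = conj (circleAverage g 0 1) :=
  (conjCLE : ℂ →L[ℝ] ℂ).circleAverage_comp_comm hg.circleIntegrable_zero_one

theorem circleAverage_re {g : ℂ → ℂ} (hg : Continuous g) :
    circleAverage (fun z ↦ (g z).re) 0 1 = (circleAverage g 0 1).re :=
  reCLM.circleAverage_comp_comm hg.circleIntegrable_zero_one

theorem norm_circleAverage_le {g : ℂ → ℂ} :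
    ‖circleAverage g 0 1‖ ≤ circleAverage (fun z ↦ ‖g z‖) 0 1 := by
  rw [circleAverage, circleAverage, norm_smul, smul_eq_mul, Real.norm_of_nonneg (by positivity)]
  gcongr
  exact intervalIntegral.norm_integral_le_integral_norm two_pi_pos.le

theorem circleAverage_conj_pow_mul_pow_mul {n p : ℕ} (hnp : n ≤ p) {G : ℂ → ℂ}
    (hG : Differentiable ℂ G) :
    circleAverage (fun z ↦ conj z ^ n * (z ^ p * G z)) 0 1 = 0 ^ (p - n) * G 0 := by
  have hdiff : Differentiable ℂ fun z ↦ z ^ (p - n) * G z := by fun_prop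
  rw [← hdiff.circleAverage_zero_one]
  refine circleAverage_congr_sphere fun z hz ↦ ?_
  have hz : conj z * z = 1 := by
    rw [conj_mul', mem_sphere_zero_iff_norm.1 hz]; simp
  calc conj z ^ n * (z ^ p * G z) = (conj z * z) ^ n * (z ^ (p - n) * G z) := by
        rw [← Nat.sub_add_cancel hnp, pow_add, mul_pow, Nat.add_sub_cancel]; ring
    _ = z ^ (p - n) * G z := by rw [hz, one_pow, one_mul]

theorem circleAverage_conj_pow_mul_pow (n p : ℕ) :
    circleAverage (fun z ↦ conj z ^ n * z ^ p) 0 1 = if n = p then 1 else 0 := by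
  have key {a b : ℕ} (hab : a ≤ b) :
      circleAverage (fun z ↦ conj z ^ a * z ^ b) 0 1 = if a = b then 1 else 0 := by
    have := circleAverage_conj_pow_mul_pow_mul hab (differentiable_const (1 : ℂ))
    simp only [mul_one] at this
    rw [this, zero_pow_eq]
    exact if_congr (by omega) rfl rfl
  rcases le_total n p with h | h
  · exact key h
  · have hconj := circleAverage_conj (g := fun z ↦ conj z ^ p * z ^ n) (by fun_prop)
    rw [key h] at hconj
    simp only [map_mul, map_pow, conj_conj] at hconj
    simp only [mul_comm (conj _ ^ n), hconj, eq_comm (a := n)]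
    split_ifs <;> simp

theorem norm_exp_sub_one_le_of_re_nonpos {w : ℂ} (hw : w.re ≤ 0) : ‖cexp w - 1‖ ≤ ‖w‖ := by
  have h := (convex_halfSpace_re_le 0).norm_image_sub_le_of_norm_deriv_le (𝕜 := ℂ) (f := cexp)
    (C := 1) (x := 0) (y := w) (fun x _ ↦ differentiable_exp x)
    (fun x hx ↦ by simpa [norm_exp] using hx) (by simp) hw
  simpa using h

/-- For `h` entire with `h 0` real, the conjugate function `im h` has at most the `L²` norm
of `re h`. -/
theorem circleAverage_norm_sq_le {h : ℂ → ℂ} (hd : Differentiable ℂ h) (h0 : (h 0).im = 0) :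
    circleAverage (fun z ↦ ‖h z‖ ^ 2) 0 1 ≤ 2 * circleAverage (fun z ↦ (h z).re ^ 2) 0 1 := by
  have hc := hd.continuous
  have hsq : circleAverage (fun z ↦ (h z ^ 2).re) 0 1 = (h 0).re ^ 2 := by
    rw [circleAverage_re (by fun_prop), Differentiable.circleAverage_zero_one (by fun_prop)]
    simp [sq, h0]
  have hsum : circleAverage (fun z ↦ ‖h z‖ ^ 2) 0 1 + circleAverage (fun z ↦ (h z ^ 2).re) 0 1 =
      2 * circleAverage (fun z ↦ (h z).re ^ 2) 0 1 := by
    rw [← circleAverage_fun_add (Continuous.circleIntegrable_zero_one (by fun_prop))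
      (Continuous.circleIntegrable_zero_one (by fun_prop)), ← smul_eq_mul,
      ← circleAverage_fun_smul]
    congr 1
    ext z
    rw [Complex.sq_norm, normSq_apply, sq (h z), mul_re, smul_eq_mul]
    ring
  nlinarith [sq_nonneg (h 0).re]

/-- Real and imaginary parts of a trigonometric polynomial are real parts of entire functions. -/
theorem exists_entire_re_eq_of_mem_span_fourier {p : C(AddCircle (1 : ℝ), ℂ)}
    (hp : p ∈ Submodule.span ℂ (Set.range (fourier (T := (1 : ℝ))))) :
    ∃ a b : ℂ → ℂ, Differentiable ℂ a ∧ Differentiable ℂ b ∧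
      ∀ x : AddCircle (1 : ℝ), (a (fourier 1 x)).re = (p x).re ∧ (b (fourier 1 x)).re = (p x).im := by
  have hpow (n : ℕ) (x : AddCircle (1 : ℝ)) : fourier (n : ℤ) x = fourier 1 x ^ n := by
    simp [fourier_apply, AddCircle.toCircle_nsmul]
  induction hp using Submodule.span_induction with
  | mem _ hx =>
    obtain ⟨n, rfl⟩ := hx
    obtain ⟨n, rfl | rfl⟩ := n.eq_nat_or_neg
    · exact ⟨fun z ↦ z ^ n, fun z ↦ -I * z ^ n, by fun_prop, by fun_prop, fun x ↦ by
        rw [hpow]; simp⟩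
    · exact ⟨fun z ↦ z ^ n, fun z ↦ I * z ^ n, by fun_prop, by fun_prop, fun x ↦ by
        rw [fourier_neg, hpow]; simp only [I_mul_re, conj_re, conj_im]; simp⟩
  | zero => exact ⟨0, 0, by fun_prop, by fun_prop, fun x ↦ by simp⟩
  | add _ _ _ _ h₁ h₂ =>
    obtain ⟨a₁, b₁, ha₁, hb₁, e₁⟩ := h₁
    obtain ⟨a₂, b₂, ha₂, hb₂, e₂⟩ := h₂
    exact ⟨a₁ + a₂, b₁ + b₂, ha₁.add ha₂, hb₁.add hb₂, fun x ↦ by simp [-fourier_apply, e₁, e₂]⟩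
  | smul c _ _ h =>
    obtain ⟨a, b, ha, hb, e⟩ := h
    exact ⟨fun z ↦ c.re * a z - c.im * b z, fun z ↦ c.im * a z + c.re * b z, by fun_prop,
      by fun_prop, fun x ↦ by simp [-fourier_apply, e, add_comm]⟩

/-- A continuous real function on the unit circle is uniformly approximated from above by real
parts of entire functions which are real at the origin. -/
theorem exists_entire_le_re_le_add {u : ℂ → ℝ} (hu : Continuous u) {δ : ℝ} (hδ : 0 < δ) :
    ∃ h : ℂ → ℂ, Differentiable ℂ h ∧ (h 0).im = 0 ∧
      ∀ z, ‖z‖ = 1 → u z ≤ (h z).re ∧ (h z).re ≤ u z + δ := by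
  let g : C(AddCircle (1 : ℝ), ℂ) := ⟨fun x ↦ ((u (fourier 1 x) + δ / 2 : ℝ) : ℂ), by fun_prop⟩
  have hg : g ∈ (Submodule.span ℂ (Set.range (fourier (T := (1 : ℝ))))).topologicalClosure := by
    rw [span_fourier_closure_eq_top]; trivial
  obtain ⟨p, hp, hgp⟩ := Metric.mem_closure_iff.1 hg (δ / 2) (by positivity)
  obtain ⟨a, b, ha, hb, hre⟩ := exists_entire_re_eq_of_mem_span_fourier hp
  refine ⟨fun z ↦ a z - (a 0).im * I, by fun_prop, by simp, fun z hz ↦ ?_⟩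
  obtain ⟨x, rfl⟩ : ∃ x : AddCircle (1 : ℝ), fourier 1 x = z := by
    obtain ⟨x, hx⟩ := (AddCircle.homeomorphCircle (T := (1 : ℝ)) one_ne_zero).surjective
      ⟨z, mem_sphere_zero_iff_norm.2 hz⟩
    refine ⟨x, ?_⟩
    rw [AddCircle.homeomorphCircle_apply] at hx
    rw [fourier_one, hx]
  have hx := (abs_re_le_norm _).trans_lt
    ((dist_eq_norm (g x) (p x) ▸ ContinuousMap.dist_apply_le_dist x).trans_lt hgp)
  have hgx : (g x).re = u (fourier 1 x) + δ / 2 := ofReal_re _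
  rw [sub_re, hgx, ← (hre x).1, abs_lt] at hx
  simp only [sub_re, re_ofReal_mul, I_re, mul_zero, sub_zero]
  constructor <;> linarith

/-- The bounded function built from blocks `f k`, each one damped by all the later `h i`. -/
noncomputable def dampedSum (f h : ℕ → ℂ → ℂ) (K : ℕ) (z : ℂ) : ℂ :=
  ∑ k ∈ Finset.range K, f k z * cexp (-(1 / 5) * ∑ i ∈ Finset.Ico (k + 1) K, h i z)

theorem dampedSum_succ (f h : ℕ → ℂ → ℂ) (K : ℕ) (z : ℂ) :
    dampedSum f h (K + 1) z = dampedSum f h K z * cexp (-(1 / 5) * h K z) + f K z := by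
  rw [dampedSum, Finset.sum_range_succ, dampedSum, Finset.sum_mul]
  congr 1
  · refine Finset.sum_congr rfl fun k hk ↦ ?_
    rw [Finset.sum_Ico_succ_top (Finset.mem_range.1 hk), mul_add, Complex.exp_add, mul_assoc]
  · simp

theorem norm_dampedSum_le {f h : ℕ → ℂ → ℂ} {z : ℂ} (hf : ∀ k, ‖f k z‖ ≤ 1)
    (hfh : ∀ k, ‖f k z‖ ≤ (h k z).re) (K : ℕ) : ‖dampedSum f h K z‖ ≤ 6 := by
  induction K with
  | zero => simp [dampedSum]
  | succ K ih =>
    have hx0 := norm_nonneg (f K z)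
    set x := ‖f K z‖
    have hexp : ‖cexp (-(1 / 5) * h K z)‖ ≤ (1 + x / 5)⁻¹ := by
      have hre : (-(1 / 5) * h K z).re = -(1 / 5) * (h K z).re := by
        simp
      rw [norm_exp, hre]
      calc rexp (-(1 / 5) * (h K z).re) ≤ rexp (-(x / 5)) :=
            Real.exp_le_exp.2 (by linarith [hfh K])
        _ = (rexp (x / 5))⁻¹ := Real.exp_neg _
        _ ≤ (1 + x / 5)⁻¹ := by
            gcongr
            linarith [Real.add_one_le_exp (x / 5)]
    rw [dampedSum_succ]
    calc ‖dampedSum f h K z * cexp (-(1 / 5) * h K z) + f K z‖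
        ≤ 6 * (1 + x / 5)⁻¹ + x := by
          refine (norm_add_le _ _).trans ?_
          rw [norm_mul]
          gcongr
      _ ≤ 6 := by
          have : 6 * (1 + x / 5)⁻¹ ≤ 6 - x := by
            rw [← div_eq_mul_inv, div_le_iff₀ (by positivity)]
            nlinarith [hf K]
          linarith

theorem differentiable_dampedSum {f h : ℕ → ℂ → ℂ} (hf : ∀ k, Differentiable ℂ (f k))
    (hh : ∀ k, Differentiable ℂ (h k)) (K : ℕ) : Differentiable ℂ (dampedSum f h K) := by
  unfold dampedSum
  fun_prop

theorem circleAverage_norm_mul_norm_le {f h : ℂ → ℂ} (hf : Continuous f) (hh : Continuous h)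
    {k i : ℕ} (hfk : circleAverage (fun z ↦ ‖f z‖ ^ 2) 0 1 ≤ (1 / 4) ^ k / 3)
    (hhi : circleAverage (fun z ↦ ‖h z‖ ^ 2) 0 1 ≤ (1 / 4) ^ i) :
    circleAverage (fun z ↦ ‖f z‖ * ‖h z‖) 0 1 ≤ 2 / 3 * (1 / 2) ^ k * (1 / 2) ^ i := by
  set a : ℝ := (1 / 2) ^ k with ha
  set b : ℝ := (1 / 2) ^ i with hb
  have ha0 : 0 < a := by positivity
  have hb0 : 0 < b := by positivity
  have ha2 : (1 / 4 : ℝ) ^ k = a ^ 2 := by rw [ha, ← pow_mul, mul_comm, pow_mul]; norm_num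
  have hb2 : (1 / 4 : ℝ) ^ i = b ^ 2 := by rw [hb, ← pow_mul, mul_comm, pow_mul]; norm_num
  rw [ha2] at hfk
  rw [hb2] at hhi
  have hle : circleAverage (fun z ↦ ‖f z‖ * ‖h z‖) 0 1 ≤
      circleAverage (fun z ↦ (b / (2 * a)) • ‖f z‖ ^ 2 + (a / (2 * b)) • ‖h z‖ ^ 2) 0 1 := by
    refine circleAverage_mono (Continuous.circleIntegrable_zero_one (by fun_prop))
      (Continuous.circleIntegrable_zero_one (by fun_prop)) fun z _ ↦ ?_
    simp only [smul_eq_mul]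
    have : b / (2 * a) * ‖f z‖ ^ 2 + a / (2 * b) * ‖h z‖ ^ 2 - ‖f z‖ * ‖h z‖ =
        (b * ‖f z‖ - a * ‖h z‖) ^ 2 / (2 * a * b) := by
      field_simp
      ring
    have : 0 ≤ (b * ‖f z‖ - a * ‖h z‖) ^ 2 / (2 * a * b) := by positivity
    linarith
  refine hle.trans ?_
  rw [circleAverage_fun_add (Continuous.circleIntegrable_zero_one (by fun_prop))
    (Continuous.circleIntegrable_zero_one (by fun_prop)), circleAverage_fun_smul,
    circleAverage_fun_smul, smul_eq_mul, smul_eq_mul]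
  calc _ ≤ b / (2 * a) * (a ^ 2 / 3) + a / (2 * b) * b ^ 2 := by gcongr
    _ = 2 / 3 * a * b := by field_simp; ring

/-- The effect of damping on the block `k` has size comparable to `4 ^ (-k)`. -/
theorem norm_circleAverage_mul_exp_sub_one_le {f h : ℕ → ℂ → ℂ} {φ : ℂ → ℂ} (hφ : Continuous φ)
    (hφ1 : ∀ z, ‖z‖ = 1 → ‖φ z‖ = 1) (hf : ∀ k, Continuous (f k)) (hh : ∀ k, Continuous (h k))
    (hre : ∀ k z, ‖z‖ = 1 → 0 ≤ (h k z).re)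
    (hfk : ∀ k, circleAverage (fun z ↦ ‖f k z‖ ^ 2) 0 1 ≤ (1 / 4) ^ k / 3)
    (hhi : ∀ k, circleAverage (fun z ↦ ‖h k z‖ ^ 2) 0 1 ≤ (1 / 4) ^ k) (k K : ℕ) :
    ‖circleAverage (fun z ↦ φ z * (f k z *
      (cexp (-(1 / 5) * ∑ i ∈ Finset.Ico (k + 1) K, h i z) - 1))) 0 1‖ ≤
      2 / 15 * (1 / 4) ^ k := by
  calc _ ≤ circleAverage (fun z ↦ ‖φ z * (f k z *
          (cexp (-(1 / 5) * ∑ i ∈ Finset.Ico (k + 1) K, h i z) - 1))‖) 0 1 :=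
        norm_circleAverage_le
    _ ≤ circleAverage (fun z ↦ (1 / 5 : ℝ) • ∑ i ∈ Finset.Ico (k + 1) K, ‖f k z‖ * ‖h i z‖) 0 1 := by
        refine circleAverage_mono (Continuous.circleIntegrable_zero_one (by fun_prop))
          (Continuous.circleIntegrable_zero_one (by fun_prop)) fun z hz ↦ ?_
        have hz : ‖z‖ = 1 := by simpa using hz
        have hexp : ‖cexp (-(1 / 5) * ∑ i ∈ Finset.Ico (k + 1) K, h i z) - 1‖ ≤
            1 / 5 * ∑ i ∈ Finset.Ico (k + 1) K, ‖h i z‖ := by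
          refine (norm_exp_sub_one_le_of_re_nonpos ?_).trans ?_
          · have : 0 ≤ ∑ i ∈ Finset.Ico (k + 1) K, (h i z).re :=
              Finset.sum_nonneg fun i _ ↦ hre i z hz
            simpa [re_sum] using this
          · rw [norm_mul]
            gcongr
            · simp
            · exact norm_sum_le _ _
        rw [norm_mul, norm_mul, hφ1 z hz, one_mul, smul_eq_mul, ← Finset.mul_sum]
        calc _ ≤ ‖f k z‖ * (1 / 5 * ∑ i ∈ Finset.Ico (k + 1) K, ‖h i z‖) := by gcongr
          _ = _ := by ring
    _ = 1 / 5 * ∑ i ∈ Finset.Ico (k + 1) K, circleAverage (fun z ↦ ‖f k z‖ * ‖h i z‖) 0 1 := by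
        rw [circleAverage_fun_smul, circleAverage_fun_sum fun i _ ↦
          Continuous.circleIntegrable_zero_one (by fun_prop), smul_eq_mul]
    _ ≤ 1 / 5 * ∑ i ∈ Finset.Ico (k + 1) K, 2 / 3 * (1 / 2) ^ k * (1 / 2) ^ i := by
        gcongr with i
        exact circleAverage_norm_mul_norm_le (hf k) (hh i) (hfk k) (hhi i)
    _ ≤ 1 / 5 * (2 / 3 * (1 / 2) ^ k * (1 / 2) ^ k) := by
        rw [← Finset.mul_sum]
        gcongr
        refine (geom_sum_Ico_le_of_lt_one (by norm_num) (by norm_num)).trans_eq ?_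
        rw [pow_succ]
        ring
    _ = 2 / 15 * (1 / 4) ^ k := by
        rw [mul_assoc (2 / 3 : ℝ), ← mul_pow]
        norm_num
        ring

section Blocks

variable {ι : Type*} [Fintype ι]

/-- The terms of level `k` of a block decomposition, with coefficients `s j * 4⁻ᵏ / 3`. -/
noncomputable def blockPoly (lam : ι → ℕ) (lev : ι → ℕ) (s : ι → ℝ) (k : ℕ) (z : ℂ) : ℂ :=
  ∑ j with lev j = k, (s j * ((1 / 4) ^ k / 3) : ℝ) * z ^ lam j

variable {lam lev : ι → ℕ} {s : ι → ℝ}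

theorem differentiable_blockPoly (k : ℕ) : Differentiable ℂ (blockPoly lam lev s k) := by
  unfold blockPoly
  fun_prop

theorem abs_blockPoly_coeff_le {ι : Type*} {s : ι → ℝ} (hs : ∀ j, |s j| ≤ 1) (k : ℕ) (j : ι) :
    |s j * ((1 / 4) ^ k / 3)| ≤ (1 / 4) ^ k / 3 := by
  rw [abs_mul, abs_of_nonneg (by positivity : (0 : ℝ) ≤ (1 / 4) ^ k / 3)]
  exact mul_le_of_le_one_left (by positivity) (hs j)

theorem norm_blockPoly_le (hs : ∀ j, |s j| ≤ 1) {k : ℕ}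
    (hcard : Finset.card {j | lev j = k} ≤ 3 * 4 ^ k) {z : ℂ} (hz : ‖z‖ = 1) :
    ‖blockPoly lam lev s k z‖ ≤ 1 := by
  have hcard' : (Finset.card {j | lev j = k} : ℝ) ≤ 3 * 4 ^ k := mod_cast hcard
  calc ‖blockPoly lam lev s k z‖ ≤ ∑ j with lev j = k, ((1 / 4) ^ k / 3 : ℝ) := by
        refine norm_sum_le_of_le _ fun j _ ↦ ?_
        rw [norm_mul, norm_pow, hz, one_pow, mul_one, norm_real]
        exact abs_blockPoly_coeff_le hs k j
    _ = Finset.card {j | lev j = k} * ((1 / 4) ^ k / 3) := by rw [Finset.sum_const, nsmul_eq_mul]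
    _ ≤ 3 * 4 ^ k * ((1 / 4) ^ k / 3) := by gcongr
    _ = 1 := by
        rw [mul_comm (3 : ℝ), mul_assoc, mul_div_cancel₀ _ three_ne_zero, ← mul_pow]
        norm_num

theorem circleAverage_conj_pow_mul_blockPoly (hlam : lam.Injective) (j : ι) (k : ℕ) :
    circleAverage (fun z ↦ conj z ^ lam j * blockPoly lam lev s k z) 0 1 =
      if lev j = k then ((s j * ((1 / 4) ^ k / 3) : ℝ) : ℂ) else 0 := by
  classical
  simp only [blockPoly, Finset.mul_sum]
  rw [circleAverage_fun_sum fun i _ ↦ Continuous.circleIntegrable_zero_one (by fun_prop)]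
  have hterm (i : ι) : circleAverage
      (fun z ↦ conj z ^ lam j * ((s i * ((1 / 4) ^ k / 3) : ℝ) * z ^ lam i)) 0 1 =
      if j = i then ((s i * ((1 / 4) ^ k / 3) : ℝ) : ℂ) else 0 := by
    simp only [mul_left_comm (conj _ ^ lam j)]
    simp only [← smul_eq_mul (a := ((s i * ((1 / 4) ^ k / 3) : ℝ) : ℂ))]
    rw [circleAverage_fun_smul, circleAverage_conj_pow_mul_pow, smul_eq_mul, mul_ite, mul_one,
      mul_zero]
    exact if_congr hlam.eq_iff rfl rfl
  simp only [hterm]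
  rw [Finset.sum_ite_eq]
  exact if_congr (by simp) rfl rfl

theorem circleAverage_norm_blockPoly_sq_le (hlam : lam.Injective) (hs : ∀ j, |s j| ≤ 1) {k : ℕ}
    (hcard : Finset.card {j | lev j = k} ≤ 3 * 4 ^ k) :
    circleAverage (fun z ↦ ‖blockPoly lam lev s k z‖ ^ 2) 0 1 ≤ (1 / 4) ^ k / 3 := by
  have hcard' : (Finset.card {j | lev j = k} : ℝ) ≤ 3 * 4 ^ k := mod_cast hcard
  have hc : Continuous (blockPoly lam lev s k) := (differentiable_blockPoly k).continuous
  have hcomplex : circleAverage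
      (fun z ↦ conj (blockPoly lam lev s k z) * blockPoly lam lev s k z) 0 1 =
      ((∑ j with lev j = k, (s j * ((1 / 4) ^ k / 3)) ^ 2 : ℝ) : ℂ) := by
    have hexpand (z : ℂ) : conj (blockPoly lam lev s k z) * blockPoly lam lev s k z =
        ∑ j with lev j = k, ((s j * ((1 / 4) ^ k / 3) : ℝ) : ℂ) •
          (conj z ^ lam j * blockPoly lam lev s k z) := by
      nth_rw 1 [blockPoly]
      rw [map_sum, Finset.sum_mul]
      refine Finset.sum_congr rfl fun j _ ↦ ?_
      rw [map_mul, map_pow, conj_ofReal, smul_eq_mul, mul_assoc]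
    simp only [hexpand]
    rw [circleAverage_fun_sum fun i _ ↦ Continuous.circleIntegrable_zero_one (by fun_prop),
      ofReal_sum]
    refine Finset.sum_congr rfl fun j hj ↦ ?_
    rw [circleAverage_fun_smul, circleAverage_conj_pow_mul_blockPoly hlam,
      if_pos (Finset.mem_filter.1 hj).2, smul_eq_mul, ← ofReal_mul, sq]
  have hreal : circleAverage (fun z ↦ ‖blockPoly lam lev s k z‖ ^ 2) 0 1 =
      ∑ j with lev j = k, (s j * ((1 / 4) ^ k / 3)) ^ 2 := by
    rw [← ofReal_re (∑ j with lev j = k, (s j * ((1 / 4) ^ k / 3)) ^ 2), ← hcomplex,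
      ← circleAverage_re (by fun_prop)]
    congr 1
    ext z
    rw [conj_mul', ← ofReal_pow, ofReal_re]
  rw [hreal]
  calc _ ≤ ∑ j with lev j = k, ((1 / 4) ^ k / 3 : ℝ) ^ 2 :=
        Finset.sum_le_sum fun j _ ↦ sq_le_sq' (abs_le.1 (abs_blockPoly_coeff_le hs k j)).1
          (abs_le.1 (abs_blockPoly_coeff_le hs k j)).2
    _ = Finset.card {j | lev j = k} * ((1 / 4) ^ k / 3) ^ 2 := by
        rw [Finset.sum_const, nsmul_eq_mul]
    _ ≤ 3 * 4 ^ k * ((1 / 4) ^ k / 3) ^ 2 := by gcongr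
    _ = (4 * (1 / 4)) ^ k * ((1 / 4) ^ k / 3) := by rw [mul_pow]; ring
    _ = (1 / 4) ^ k / 3 := by norm_num

/-- An entire function dominating `f` on the circle through its real part, of comparable
`L²` norm. -/
theorem exists_entire_norm_le_re {f : ℂ → ℂ} (hf : Continuous f)
    (hf1 : ∀ z, ‖z‖ = 1 → ‖f z‖ ≤ 1) {a : ℝ} (ha : 0 < a) (ha1 : a ≤ 1)
    (hfa : circleAverage (fun z ↦ ‖f z‖ ^ 2) 0 1 ≤ a / 3) :
    ∃ h : ℂ → ℂ, Differentiable ℂ h ∧ (∀ z, ‖z‖ = 1 → ‖f z‖ ≤ (h z).re) ∧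
      circleAverage (fun z ↦ ‖h z‖ ^ 2) 0 1 ≤ a := by
  obtain ⟨h, hd, h0, hre⟩ := exists_entire_le_re_le_add hf.norm (δ := a / 24) (by positivity)
  refine ⟨h, hd, fun z hz ↦ (hre z hz).1, (circleAverage_norm_sq_le hd h0).trans ?_⟩
  have hc := hd.continuous
  have hle : circleAverage (fun z ↦ (h z).re ^ 2) 0 1 ≤
      circleAverage (fun z ↦ ‖f z‖ ^ 2 + a / 8) 0 1 := by
    refine circleAverage_mono (Continuous.circleIntegrable_zero_one (by fun_prop))
      (Continuous.circleIntegrable_zero_one (by fun_prop)) fun z hz ↦ ?_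
    have hz : ‖z‖ = 1 := by simpa using hz
    obtain ⟨h₁, h₂⟩ := hre z hz
    nlinarith [norm_nonneg (f z), hf1 z hz]
  rw [circleAverage_fun_add (Continuous.circleIntegrable_zero_one (by fun_prop))
    (Continuous.circleIntegrable_zero_one (by fun_prop)), circleAverage_const] at hle
  linarith

/-- A bounded entire function whose Fourier coefficients at the frequencies `lam j` are close to
prescribed values of size `4 ^ (-lev j)`. -/
theorem exists_bounded_entire_circleAverage_near (hlam : lam.Injective)
    (hlev : ∀ i j, lev i < lev j → lam j < lam i)
    (hcard : ∀ k, Finset.card {j | lev j = k} ≤ 3 * 4 ^ k) (hs : ∀ j, |s j| ≤ 1) :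
    ∃ F : ℂ → ℂ, Differentiable ℂ F ∧ (∀ z, ‖z‖ = 1 → ‖F z‖ ≤ 6) ∧
      ∀ j, ‖circleAverage (fun z ↦ conj z ^ lam j * F z) 0 1 -
        (s j * ((1 / 4) ^ lev j / 3) : ℝ)‖ ≤ 8 / 45 * (1 / 4) ^ lev j := by
  set f := blockPoly lam lev s with hf
  have hfd (k : ℕ) : Differentiable ℂ (f k) := differentiable_blockPoly k
  have hfc (k : ℕ) : Continuous (f k) := (hfd k).continuous
  have hf1 (k : ℕ) (z : ℂ) (hz : ‖z‖ = 1) : ‖f k z‖ ≤ 1 := norm_blockPoly_le hs (hcard k) hz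
  have hf2 (k : ℕ) := circleAverage_norm_blockPoly_sq_le hlam hs (hcard k)
  choose h hhd hfh hh2 using fun k ↦ exists_entire_norm_le_re (hfc k) (hf1 k)
    (a := (1 / 4) ^ k) (by positivity) (pow_le_one₀ (by norm_num) (by norm_num)) (hf2 k)
  have hhc (k : ℕ) : Continuous (h k) := (hhd k).continuous
  set K := Finset.univ.sup lev + 1
  refine ⟨dampedSum f h K, differentiable_dampedSum hfd hhd K,
    fun z hz ↦ norm_dampedSum_le (fun k ↦ hf1 k z hz) (fun k ↦ hfh k z hz) K, fun j ↦ ?_⟩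
  have hjK : lev j < K := Nat.lt_succ_of_le (Finset.le_sup (Finset.mem_univ j))
  set G : ℕ → ℂ → ℂ := fun k z ↦ cexp (-(1 / 5) * ∑ i ∈ Finset.Ico (k + 1) K, h i z) - 1 with hG
  have hGd (k : ℕ) : Differentiable ℂ (G k) := by fun_prop
  have hGc (k : ℕ) : Continuous (G k) := (hGd k).continuous
  set err : ℕ → ℂ := fun k ↦ circleAverage (fun z ↦ conj z ^ lam j * (f k z * G k z)) 0 1 with herr
  have hsplit : circleAverage (fun z ↦ conj z ^ lam j * dampedSum f h K z) 0 1 =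
      (s j * ((1 / 4) ^ lev j / 3) : ℝ) + ∑ k ∈ Finset.range K, err k := by
    have hexpand (z : ℂ) : conj z ^ lam j * dampedSum f h K z = ∑ k ∈ Finset.range K,
        (conj z ^ lam j * f k z + conj z ^ lam j * (f k z * G k z)) := by
      rw [dampedSum, Finset.mul_sum]
      refine Finset.sum_congr rfl fun k _ ↦ ?_
      simp only [hG]
      ring
    simp only [hexpand]
    rw [circleAverage_fun_sum fun k _ ↦ Continuous.circleIntegrable_zero_one (by fun_prop)]
    have hk (k : ℕ) : circleAverage (fun z ↦ conj z ^ lam j * f k z +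
        conj z ^ lam j * (f k z * G k z)) 0 1 =
        (if lev j = k then ((s j * ((1 / 4) ^ k / 3) : ℝ) : ℂ) else 0) + err k := by
      rw [circleAverage_fun_add (Continuous.circleIntegrable_zero_one (by fun_prop))
        (Continuous.circleIntegrable_zero_one (by fun_prop)), hf,
        circleAverage_conj_pow_mul_blockPoly hlam]
    simp only [hk]
    rw [Finset.sum_add_distrib, Finset.sum_ite_eq, if_pos (Finset.mem_range.2 hjK)]
  have hlow (k : ℕ) (hk : k < lev j) : err k = 0 := by
    have hexpand (z : ℂ) : conj z ^ lam j * (f k z * G k z) = ∑ i with lev i = k,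
        ((s i * ((1 / 4) ^ k / 3) : ℝ) : ℂ) • (conj z ^ lam j * (z ^ lam i * G k z)) := by
      rw [hf, blockPoly, Finset.sum_mul, Finset.mul_sum]
      refine Finset.sum_congr rfl fun i _ ↦ ?_
      rw [smul_eq_mul]
      ring
    simp only [herr, hexpand]
    rw [circleAverage_fun_sum fun i _ ↦ Continuous.circleIntegrable_zero_one (by fun_prop)]
    refine Finset.sum_eq_zero fun i hi ↦ ?_
    have hij : lam j < lam i := hlev i j ((Finset.mem_filter.1 hi).2 ▸ hk)
    rw [circleAverage_fun_smul, circleAverage_conj_pow_mul_pow_mul hij.le (hGd k),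
      zero_pow (Nat.sub_ne_zero_of_lt hij), zero_mul, smul_zero]
  rw [hsplit, add_sub_cancel_left, ← Finset.sum_range_add_sum_Ico _ hjK.le,
    Finset.sum_eq_zero fun k hk ↦ hlow k (Finset.mem_range.1 hk), zero_add]
  calc ‖∑ k ∈ Finset.Ico (lev j) K, err k‖
      ≤ ∑ k ∈ Finset.Ico (lev j) K, 2 / 15 * (1 / 4) ^ k :=
        norm_sum_le_of_le _ fun k _ ↦ norm_circleAverage_mul_exp_sub_one_le (by fun_prop)
          (fun z hz ↦ by simp [hz]) hfc hhc
          (fun k z hz ↦ (norm_nonneg _).trans (hfh k z hz)) hf2 hh2 k K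
    _ ≤ 2 / 15 * ((1 / 4) ^ lev j / (1 - 1 / 4)) := by
        rw [← Finset.mul_sum]
        gcongr
        exact geom_sum_Ico_le_of_lt_one (by norm_num) (by norm_num)
    _ = 8 / 45 * (1 / 4) ^ lev j := by ring

/-- Lower bound for the `L¹` norm of a real cosine polynomial, with frequencies grouped in
levels. -/
theorem sum_abs_mul_le_circleAverage_abs (hlam : lam.Injective)
    (hlev : ∀ i j, lev i < lev j → lam j < lam i)
    (hcard : ∀ k, Finset.card {j | lev j = k} ≤ 3 * 4 ^ k) (A : ι → ℝ) :
    7 / 90 * ∑ j, |A j| * (1 / 4) ^ lev j ≤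
      6 * circleAverage (fun z ↦ |∑ j, A j * (z ^ lam j).re|) 0 1 := by
  obtain ⟨F, hFd, hF6, hFj⟩ := exists_bounded_entire_circleAverage_near hlam hlev hcard
    (s := fun j ↦ (SignType.sign (A j) : ℝ)) fun j ↦ by
      cases SignType.sign (A j) <;> simp
  have hFc := hFd.continuous
  have hcoeff (j : ι) : circleAverage (fun z ↦ ((z ^ lam j).re : ℂ) * F z) 0 1 =
      (1 / 2 : ℂ) * (circleAverage (fun z ↦ conj z ^ lam j * F z) 0 1 + 0 ^ lam j * F 0) := by
    have hexpand (z : ℂ) : ((z ^ lam j).re : ℂ) * F z =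
        (1 / 2 : ℂ) • (conj z ^ lam j * F z + z ^ lam j * F z) := by
      rw [re_eq_add_conj, map_pow, smul_eq_mul]
      ring
    simp only [hexpand]
    rw [circleAverage_fun_smul, circleAverage_fun_add
      (Continuous.circleIntegrable_zero_one (by fun_prop))
      (Continuous.circleIntegrable_zero_one (by fun_prop)), smul_eq_mul,
      Differentiable.circleAverage_zero_one (g := fun z ↦ z ^ lam j * F z) (by fun_prop)]
  have hterm (j : ι) : 7 / 90 * (|A j| * (1 / 4) ^ lev j) ≤
      A j * (circleAverage (fun z ↦ ((z ^ lam j).re : ℂ) * F z) 0 1).re := by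
    set C := circleAverage (fun z ↦ conj z ^ lam j * F z) 0 1 with hC
    set w : ℝ := (1 / 4) ^ lev j
    have hw0 : 0 < w := by positivity
    have hmain : 7 / 45 * (|A j| * w) ≤ A j * C.re := by
      have herr := (abs_re_le_norm _).trans (hFj j)
      rw [sub_re, ofReal_re] at herr
      have hmul : |A j * (C.re - SignType.sign (A j) * (w / 3))| ≤ |A j| * (8 / 45 * w) := by
        rw [abs_mul]
        gcongr
      have hsign : A j * (SignType.sign (A j) : ℝ) = |A j| := self_mul_sign (A j)
      have := (abs_le.1 hmul).1
      rw [mul_sub, ← mul_assoc (A j), hsign] at this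
      linarith
    rw [hcoeff j, ← hC]
    rcases Nat.eq_zero_or_pos (lam j) with h0 | h0
    · have hC0 : C = F 0 := by
        rw [hC, h0]
        simpa using hFd.circleAverage_zero_one
      have hhalf : (1 / 2 : ℂ) * (C + C) = C := by ring
      rw [h0, ← hC0, pow_zero, one_mul, hhalf]
      linarith [mul_nonneg (abs_nonneg (A j)) hw0.le]
    · rw [zero_pow h0.ne', zero_mul, add_zero]
      have : ((1 / 2 : ℂ) * C).re = 1 / 2 * C.re := by simp
      rw [this]
      linarith
  have hsum : circleAverage (fun z ↦ ((∑ j, A j * (z ^ lam j).re : ℝ) : ℂ) * F z) 0 1 =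
      ∑ j, (A j : ℂ) * circleAverage (fun z ↦ ((z ^ lam j).re : ℂ) * F z) 0 1 := by
    simp only [ofReal_sum, ofReal_mul, Finset.sum_mul, mul_assoc]
    rw [circleAverage_fun_sum fun i _ ↦ Continuous.circleIntegrable_zero_one (by fun_prop)]
    exact Finset.sum_congr rfl fun j _ ↦ circleAverage_fun_smul (a := (A j : ℂ))
  calc 7 / 90 * ∑ j, |A j| * (1 / 4) ^ lev j
      ≤ ∑ j, A j * (circleAverage (fun z ↦ ((z ^ lam j).re : ℂ) * F z) 0 1).re := by
        rw [Finset.mul_sum]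
        exact Finset.sum_le_sum fun j _ ↦ hterm j
    _ = (circleAverage (fun z ↦ ((∑ j, A j * (z ^ lam j).re : ℝ) : ℂ) * F z) 0 1).re := by
        rw [hsum, re_sum]
        simp only [re_ofReal_mul]
    _ ≤ circleAverage (fun z ↦ ‖((∑ j, A j * (z ^ lam j).re : ℝ) : ℂ) * F z‖) 0 1 :=
        (re_le_norm _).trans norm_circleAverage_le
    _ ≤ circleAverage (fun z ↦ (6 : ℝ) • |∑ j, A j * (z ^ lam j).re|) 0 1 := by
        refine circleAverage_mono (Continuous.circleIntegrable_zero_one (by fun_prop))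
          (Continuous.circleIntegrable_zero_one (by fun_prop)) fun z hz ↦ ?_
        rw [norm_mul, norm_real, Real.norm_eq_abs, smul_eq_mul, mul_comm]
        gcongr
        exact hF6 z (by simpa using hz)
    _ = _ := by rw [circleAverage_fun_smul, smul_eq_mul]

end Blocks

theorem integral_abs_cos_sum_eq_circleAverage {ι : Type*} [Fintype ι] (lam : ι → ℕ) (A : ι → ℝ) :
    ∫ t in (-π)..π, |∑ j, A j * Real.cos (lam j * t)| =
      2 * π * circleAverage (fun z ↦ |∑ j, A j * (z ^ lam j).re|) 0 1 := by
  rw [circleAverage_eq_integral_add (-π), intervalIntegral.integral_comp_add_right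
    (fun θ ↦ |∑ j, A j * (circleMap 0 1 θ ^ lam j).re|), smul_eq_mul,
    mul_inv_cancel_left₀ two_pi_pos.ne', zero_add, two_mul, add_neg_cancel_right]
  refine intervalIntegral.integral_congr fun t _ ↦ ?_
  have hre (j : ι) : (circleMap 0 1 t ^ lam j).re = Real.cos (lam j * t) := by
    rw [circleMap_zero, ofReal_one, one_mul, ← Complex.exp_nat_mul, ← mul_assoc,
      ← ofReal_natCast, ← ofReal_mul, exp_ofReal_mul_I_re]
  simp only [hre]

/-- The cosine-polynomial form of the Littlewood conjecture inequality. -/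
theorem cosine_littlewood_lower_bound (m : ℕ) (lam : Fin (m + 1) → ℕ)
    (hmono : StrictMono lam) (A : Fin (m + 1) → ℝ) :
    (1 / 60) * ∑ j : Fin (m + 1), |A j| / ((m : ℝ) - (j : ℕ) + 1) ≤
      ∫ t in (-Real.pi)..Real.pi, |∑ j : Fin (m + 1), A j * Real.cos ((lam j : ℝ) * t)| := by
  have hlev (i j : Fin (m + 1)) (hij : Nat.log 4 (m - i + 1) < Nat.log 4 (m - j + 1)) :
      lam j < lam i := by
    refine hmono (Fin.lt_def.2 ?_)
    by_contra! hle
    exact hij.not_ge (Nat.log_mono_right (by omega))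
  have hcard (k : ℕ) :
      Finset.card {j : Fin (m + 1) | Nat.log 4 (m - j + 1) = k} ≤ 3 * 4 ^ k := by
    calc _ ≤ (Finset.Ico (4 ^ k) (4 ^ (k + 1))).card := by
          refine Finset.card_le_card_of_injOn (fun j ↦ m - j + 1) (fun j hj ↦ ?_) fun i _ j _ h ↦ ?_
          · have hk := (Finset.mem_filter.1 hj).2
            exact Finset.mem_coe.2 (Finset.mem_Ico.2
              ((Nat.log_eq_iff (Or.inr ⟨by norm_num, Nat.succ_ne_zero _⟩)).1 hk))
          · have := i.is_lt
            have := j.is_lt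
            simp only at h
            omega
      _ = 3 * 4 ^ k := by rw [Nat.card_Ico, pow_succ]; lia
  have hbound := sum_abs_mul_le_circleAverage_abs hmono.injective hlev hcard A
  rw [integral_abs_cos_sum_eq_circleAverage]
  have hsum : ∑ j : Fin (m + 1), |A j| / ((m : ℝ) - (j : ℕ) + 1) ≤
      ∑ j : Fin (m + 1), |A j| * (1 / 4) ^ Nat.log 4 (m - j + 1) := by
    refine Finset.sum_le_sum fun j _ ↦ ?_
    have hcast : ((m : ℝ) - (j : ℕ) + 1) = ((m - j + 1 : ℕ) : ℝ) := by
      push_cast [Nat.cast_sub (Nat.le_of_lt_succ j.is_lt)]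
      rfl
    rw [hcast, div_eq_mul_inv, one_div, inv_pow]
    gcongr
    exact_mod_cast Nat.pow_log_le_self 4 (Nat.succ_ne_zero _)
  have hnonneg : 0 ≤ circleAverage (fun z ↦ |∑ j, A j * (z ^ lam j).re|) 0 1 :=
    circleAverage_nonneg_of_nonneg fun _ _ ↦ abs_nonneg _
  nlinarith [pi_gt_three]
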